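/- arXiv:2005.14393 — 5 statements merged into one kernel-verified Lean document; each statement's English description precedes it below -/
import Mathlib

section
/- Every function G in 𝒢₀ is continuously differentiable on [0,1] and satisfies the boundary conditions G′(0) = G′(1) = G(0) − G(1). -/
/-- The trigonometric functions `θ_n`, `n ∈ ℤ`: for `n ≥ 1`, `θ_n (x) = sin (k_n (x - 1/2))`,
and for `n ≤ 0`, `θ_n (x) = cos (2 (-n) π x)`. -/
noncomputable def theta (k : ℕ → ℝ) (n : ℤ) : ℝ → ℝ :=
  if 1 ≤ n then fun x => Real.sin (k n.toNat * (x - 1 / 2))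
  else fun x => Real.cos (2 * (-n : ℤ) * Real.pi * x)

theorem mul_cos_half_eq_of_tan_half_eq {κ : ℝ} (hκ : κ ≠ 0)
    (h : Real.tan (κ / 2) = -κ / 2) :
    κ * Real.cos (κ / 2) = -2 * Real.sin (κ / 2) := by
  have hcos : Real.cos (κ / 2) ≠ 0 := by
    intro h0
    rw [Real.tan_eq_sin_div_cos, h0, div_zero] at h
    exact hκ (by linarith)
  rw [Real.tan_eq_sin_div_cos, div_eq_iff hcos] at h
  rw [h]
  ring

theorem deriv_sin_mul_sub (κ c x : ℝ) :
    deriv (fun x => Real.sin (κ * (x - c))) x = κ * Real.cos (κ * (x - c)) := by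
  have h := (((hasDerivAt_id x).sub_const c).const_mul κ).sin
  rw [mul_one, mul_comm] at h
  exact h.deriv

theorem deriv_cos_mul (a x : ℝ) :
    deriv (fun x => Real.cos (a * x)) x = -(a * Real.sin (a * x)) := by
  have h := ((hasDerivAt_id x).const_mul a).cos
  rw [mul_one, neg_mul, mul_comm] at h
  exact h.deriv

theorem contDiff_theta (k : ℕ → ℝ) (n : ℤ) : ContDiff ℝ 1 (theta k n) := by
  unfold theta
  split_ifs <;> fun_prop

theorem deriv_theta_boundary {k : ℕ → ℝ}
    (hk : ∀ n : ℕ, 1 ≤ n → k n ≠ 0 ∧ Real.tan (k n / 2) = -(k n) / 2) (n : ℤ) :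
    deriv (theta k n) 0 = theta k n 0 - theta k n 1 ∧
      deriv (theta k n) 1 = theta k n 0 - theta k n 1 := by
  unfold theta
  split_ifs with hn
  · obtain ⟨hne, htan⟩ := hk n.toNat (by omega)
    have key := mul_cos_half_eq_of_tan_half_eq hne htan
    have h0 : k n.toNat * (0 - 1 / 2) = -(k n.toNat / 2) := by ring
    have h1 : k n.toNat * (1 - 1 / 2) = k n.toNat / 2 := by ring
    simp only [deriv_sin_mul_sub, h0, h1, Real.sin_neg, Real.cos_neg]
    constructor <;> linarith
  · have hval : 2 * ((-n : ℤ) : ℝ) * Real.pi = (-n : ℤ) * (2 * Real.pi) := by ring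
    have hcos : Real.cos (2 * ((-n : ℤ) : ℝ) * Real.pi) = 1 := by
      rw [hval, Real.cos_int_mul_two_pi]
    have hsin : Real.sin (2 * ((-n : ℤ) : ℝ) * Real.pi) = 0 := by
      simpa using Real.sin_int_mul_pi (2 * -n)
    simp only [deriv_cos_mul, mul_zero, mul_one, hcos, hsin, Real.sin_zero, Real.cos_zero]
    norm_num

/-- Every `G` in `𝒢₀`, the linear span of the `θ_n`, is continuously differentiable on `[0,1]`
and satisfies the boundary conditions `G'(0) = G'(1) = G(0) - G(1)`. -/
theorem span_theta_boundary_conditions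
    (k : ℕ → ℝ)
    (hk : ∀ n : ℕ, 1 ≤ n →
      k n ∈ Set.Ioo ((2 * (n : ℝ) - 1) * Real.pi) ((2 * (n : ℝ) + 1) * Real.pi) ∧
        Real.tan (k n / 2) = -(k n) / 2)
    (G : ℝ → ℝ) (hG : G ∈ Submodule.span ℝ (Set.range (theta k))) :
    ContDiffOn ℝ 1 G (Set.Icc (0 : ℝ) 1) ∧
      deriv G 0 = G 0 - G 1 ∧ deriv G 1 = G 0 - G 1 := by
  have hk' : ∀ n : ℕ, 1 ≤ n → k n ≠ 0 ∧ Real.tan (k n / 2) = -(k n) / 2 := by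
    intro n hn
    obtain ⟨⟨hlow, -⟩, htan⟩ := hk n hn
    have hn' : (1 : ℝ) ≤ n := by exact_mod_cast hn
    have hpos : 0 < (2 * (n : ℝ) - 1) * Real.pi := mul_pos (by linarith) Real.pi_pos
    exact ⟨(hpos.trans hlow).ne', htan⟩
  suffices h : ContDiff ℝ 1 G ∧ deriv G 0 = G 0 - G 1 ∧ deriv G 1 = G 0 - G 1 from
    ⟨h.1.contDiffOn, h.2⟩
  induction hG using Submodule.span_induction with
  | mem f hf =>
    obtain ⟨n, rfl⟩ := hf
    exact ⟨contDiff_theta k n, deriv_theta_boundary hk' n⟩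
  | zero => exact ⟨contDiff_const, by simp⟩
  | add f g _ _ hf hg =>
    obtain ⟨hf, hf0, hf1⟩ := hf
    obtain ⟨hg, hg0, hg1⟩ := hg
    have hd (x : ℝ) : deriv (f + g) x = deriv f x + deriv g x :=
      deriv_add (hf.differentiable one_ne_zero x) (hg.differentiable one_ne_zero x)
    refine ⟨hf.add hg, ?_, ?_⟩ <;> simp only [hd, Pi.add_apply] <;> linarith
  | smul c f _ hf =>
    obtain ⟨hf, hf0, hf1⟩ := hf
    have hd (x : ℝ) : deriv (c • f) x = c * deriv f x :=
      deriv_const_smul c (hf.differentiable one_ne_zero x)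
    refine ⟨contDiff_const.smul hf, ?_, ?_⟩ <;>
      simp only [hd, hf0, hf1, Pi.smul_apply, smul_eq_mul, mul_sub]
end

section
/- Let G ∈ C²([0,1]) be not identically zero and let λ ∈ ℝ be such that G″(u) = λ G(u) for all u ∈ [0,1] and G′(0) = G′(1) = G(0) − G(1). Then either λ = −(2nπ)² for some integer n ≥ 0, or λ = −k_n² for some integer n ≥ 1. That is, the numbers e_{−n} = −(2nπ)² (n ≥ 0) and e_n = −k_n² (n ≥ 1) are all the eigenvalues of the second-derivative operator on C²([0,1]) subject to the boundary conditions G′(0) = G′(1) = G(0) − G(1). -/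
/-- If `G'' = lam * G` on `[0,1]`, `C' = lam * S` and `S' = C`, then the Wronskian-type expressions
of `G` against the translates of `C` and `S` centred at `1/2` are constant on `[0,1]`. -/
theorem wronskian_eq_of_second_derivative_eq {G H C S : ℝ → ℝ} {lam : ℝ}
    (hG : ∀ u ∈ Set.Icc (0 : ℝ) 1, HasDerivWithinAt G (H u) (Set.Icc 0 1) u)
    (hH : ∀ u ∈ Set.Icc (0 : ℝ) 1, HasDerivWithinAt H (lam * G u) (Set.Icc 0 1) u)
    (hC : ∀ x, HasDerivAt C (lam * S x) x) (hS : ∀ x, HasDerivAt S (C x) x)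
    {u : ℝ} (hu : u ∈ Set.Icc (0 : ℝ) 1) :
    H u * C (u - 1 / 2) - lam * (G u * S (u - 1 / 2)) =
        H 0 * C (-(1 / 2)) - lam * (G 0 * S (-(1 / 2))) ∧
      H u * S (u - 1 / 2) - G u * C (u - 1 / 2) =
        H 0 * S (-(1 / 2)) - G 0 * C (-(1 / 2)) := by
  have key : ∀ W : ℝ → ℝ, (∀ x ∈ Set.Icc (0 : ℝ) 1, HasDerivWithinAt W 0 (Set.Icc 0 1) x) →
      W u = W 0 := fun W hW ↦
    constant_of_derivWithin_zero (fun x hx ↦ (hW x hx).differentiableWithinAt)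
      (fun x hx ↦ (hW x (Set.Ico_subset_Icc_self hx)).derivWithin
        (uniqueDiffOn_Icc one_pos x (Set.Ico_subset_Icc_self hx))) u hu
  have hCu (x : ℝ) : HasDerivAt (fun y ↦ C (y - 1 / 2)) (lam * S (x - 1 / 2)) x :=
    (hC _).comp_sub_const x (1 / 2)
  have hSu (x : ℝ) : HasDerivAt (fun y ↦ S (y - 1 / 2)) (C (x - 1 / 2)) x :=
    (hS _).comp_sub_const x (1 / 2)
  constructor
  · have := key (fun y ↦ H y * C (y - 1 / 2) - lam * (G y * S (y - 1 / 2))) fun x hx ↦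
      ((((hH x hx).mul (hCu x).hasDerivWithinAt).sub
        (((hG x hx).mul (hSu x).hasDerivWithinAt).const_mul lam)).congr_deriv (by ring))
    simpa only [zero_sub] using this
  · have := key (fun y ↦ H y * S (y - 1 / 2) - G y * C (y - 1 / 2)) fun x hx ↦
      ((((hH x hx).mul (hSu x).hasDerivWithinAt).sub
        ((hG x hx).mul (hCu x).hasDerivWithinAt)).congr_deriv (by ring))
    simpa only [zero_sub] using this

/-- Characteristic equation of the boundary value problem `G'' = lam * G`,
`G'(0) = G'(1) = G(0) - G(1)`, in terms of a fundamental system `C`, `S`. -/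
theorem characteristic_equation_slow_bond {G H C S : ℝ → ℝ} {lam : ℝ}
    (hG : ∀ u ∈ Set.Icc (0 : ℝ) 1, HasDerivWithinAt G (H u) (Set.Icc 0 1) u)
    (hH : ∀ u ∈ Set.Icc (0 : ℝ) 1, HasDerivWithinAt H (lam * G u) (Set.Icc 0 1) u)
    (hC : ∀ x, HasDerivAt C (lam * S x) x) (hS : ∀ x, HasDerivAt S (C x) x)
    (hCS : ∀ x, C x ^ 2 - lam * S x ^ 2 = 1) (hC_even : C.Even) (hS_odd : S.Odd)
    (hG_ne : ∃ u ∈ Set.Icc (0 : ℝ) 1, G u ≠ 0)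
    (h0 : H 0 = G 0 - G 1) (h1 : H 1 = G 0 - G 1) :
    lam * S (1 / 2) = 0 ∨ 2 * S (1 / 2) + C (1 / 2) = 0 := by
  by_contra! h
  obtain ⟨u, hu, hGu⟩ := hG_ne
  obtain ⟨e1, e2⟩ := wronskian_eq_of_second_derivative_eq hG hH hC hS
    (Set.right_mem_Icc.2 zero_le_one)
  obtain ⟨w1, w2⟩ := wronskian_eq_of_second_derivative_eq hG hH hC hS hu
  rw [show (1 : ℝ) - 1 / 2 = 1 / 2 by norm_num] at e1 e2
  rw [hC_even, hS_odd, h0] at e1 e2 w1 w2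
  rw [h1] at e1 e2
  have hsum : G 0 + G 1 = 0 := (mul_eq_zero.1 (by linear_combination -e1 :
    lam * S (1 / 2) * (G 0 + G 1) = 0)).resolve_left h.1
  have hdiff : G 0 - G 1 = 0 := (mul_eq_zero.1 (by linear_combination e2 :
    (2 * S (1 / 2) + C (1 / 2)) * (G 0 - G 1) = 0)).resolve_left h.2
  have hG0 : G 0 = 0 := by linarith
  rw [hdiff, hG0] at w1 w2
  apply hGu
  linear_combination
    S (u - 1 / 2) * w1 - C (u - 1 / 2) * w2 - G u * hCS (u - 1 / 2)

/-- A nonzero eigenvalue of the problem `G'' = lam * G`, `G'(0) = G'(1) = G(0) - G(1)` is negative: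
`lam = -w ^ 2` with `w` a positive zero of the characteristic equation. -/
theorem exists_frequency_of_slow_bond {G H : ℝ → ℝ} {lam : ℝ}
    (hG : ∀ u ∈ Set.Icc (0 : ℝ) 1, HasDerivWithinAt G (H u) (Set.Icc 0 1) u)
    (hH : ∀ u ∈ Set.Icc (0 : ℝ) 1, HasDerivWithinAt H (lam * G u) (Set.Icc 0 1) u)
    (hG_ne : ∃ u ∈ Set.Icc (0 : ℝ) 1, G u ≠ 0)
    (h0 : H 0 = G 0 - G 1) (h1 : H 1 = G 0 - G 1) :
    lam = 0 ∨ ∃ w : ℝ, 0 < w ∧ lam = -w ^ 2 ∧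
      (Real.sin (w / 2) = 0 ∨ 2 * Real.sin (w / 2) + w * Real.cos (w / 2) = 0) := by
  rcases lt_trichotomy lam 0 with hneg | rfl | hpos
  · right
    have hw : 0 < √(-lam) := Real.sqrt_pos.2 (neg_pos.2 hneg)
    have hlam : lam = -√(-lam) ^ 2 := by rw [Real.sq_sqrt (by linarith)]; ring
    refine ⟨√(-lam), hw, hlam, ?_⟩
    generalize √(-lam) = w at hw hlam
    have hlin (x : ℝ) : HasDerivAt (fun y ↦ w * y) w x := by
      simpa using (hasDerivAt_id x).const_mul w
    subst hlam
    have h := characteristic_equation_slow_bond (C := fun x ↦ Real.cos (w * x))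
      (S := fun x ↦ Real.sin (w * x) / w) hG hH
      (fun x ↦ (hlin x).cos.congr_deriv (by field_simp))
      (fun x ↦ ((hlin x).sin.div_const w).congr_deriv (by field_simp))
      (fun x ↦ by
        field_simp
        linear_combination Real.sin_sq_add_cos_sq (w * x))
      (fun x ↦ by simp) (fun x ↦ by simp [neg_div]) hG_ne h0 h1
    simp only [mul_one_div] at h
    refine h.imp (fun h ↦ by simpa [hw.ne'] using h) fun h ↦ ?_
    field_simp at h
    linear_combination h
  · exact Or.inl rfl
  · exfalso
    have hw : 0 < √lam := Real.sqrt_pos.2 hpos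
    have hlam : lam = √lam ^ 2 := (Real.sq_sqrt hpos.le).symm
    generalize √lam = w at hw hlam
    have hlin (x : ℝ) : HasDerivAt (fun y ↦ w * y) w x := by
      simpa using (hasDerivAt_id x).const_mul w
    subst hlam
    have h := characteristic_equation_slow_bond (C := fun x ↦ Real.cosh (w * x))
      (S := fun x ↦ Real.sinh (w * x) / w) hG hH
      (fun x ↦ (hlin x).cosh.congr_deriv (by field_simp))
      (fun x ↦ ((hlin x).sinh.div_const w).congr_deriv (by field_simp))
      (fun x ↦ by
        field_simp
        linear_combination Real.cosh_sq_sub_sinh_sq (w * x))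
      (fun x ↦ by simp) (fun x ↦ by simp [neg_div]) hG_ne h0 h1
    have hsinh : 0 < Real.sinh (w * (1 / 2)) := Real.sinh_pos_iff.2 (by positivity)
    have hcosh := Real.cosh_pos (w * (1 / 2))
    rcases h with h | h
    · exact absurd h (by positivity)
    · exact absurd h (by positivity)

/-- On each branch of the tangent, `tan y = -y` has at most one solution. -/
theorem eq_of_tan_eq_neg_self {x y : ℝ} {n : ℕ}
    (hx : |x - n * Real.pi| < Real.pi / 2) (hy : |y - n * Real.pi| < Real.pi / 2)
    (htx : Real.tan x = -x) (hty : Real.tan y = -y) : x = y := by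
  have hmono : StrictMonoOn Real.tan (Set.Ioo (-(Real.pi / 2)) (Real.pi / 2)) :=
    Real.strictMonoOn_tan
  rw [abs_lt] at hx hy
  rw [← Real.tan_sub_nat_mul_pi x n] at htx
  rw [← Real.tan_sub_nat_mul_pi y n] at hty
  rcases lt_trichotomy x y with h | h | h
  · linarith [hmono hx hy (by linarith)]
  · exact h
  · linarith [hmono hy hx (by linarith)]

/-- A positive solution of `tan y = -y` lies on the branch of the tangent around `n * π` for
some `n ≥ 1`. -/
theorem exists_branch_of_tan_eq_neg_self {y : ℝ} (hy : 0 < y) (hcos : Real.cos y ≠ 0)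
    (ht : Real.tan y = -y) : ∃ n : ℕ, 1 ≤ n ∧ |y - n * Real.pi| < Real.pi / 2 := by
  have hpi := Real.pi_pos
  set n := ⌊y / Real.pi + 1 / 2⌋₊
  have hn1 : (n : ℝ) ≤ y / Real.pi + 1 / 2 := Nat.floor_le (by positivity)
  have hn2 : y / Real.pi + 1 / 2 < n + 1 := Nat.lt_floor_add_one _
  have hyd : y / Real.pi * Real.pi = y := by field_simp
  have hlow : n * Real.pi - Real.pi / 2 ≤ y := by nlinarith
  have hupp : y < n * Real.pi + Real.pi / 2 := by nlinarith
  have hne : n * Real.pi - Real.pi / 2 ≠ y := by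
    rintro h
    exact hcos (by rw [← h, Real.cos_sub_pi_div_two, Real.sin_nat_mul_pi])
  refine ⟨n, Nat.one_le_iff_ne_zero.2 fun h0 ↦ ?_, ?_⟩
  · rw [h0] at hupp
    have := Real.tan_pos_of_pos_of_lt_pi_div_two hy (by simpa using hupp)
    linarith
  · have := lt_of_le_of_ne hlow hne
    rw [abs_lt]
    constructor <;> linarith


/-- Eigenvalues of the second derivative on `C²([0,1])` with boundary conditions
`G'(0) = G'(1) = G(0) - G(1)`: if `G` is not identically zero on `[0,1]`, satisfies
`G'' = λ G` on `[0,1]` and the boundary conditions, then `λ = -(2nπ)²` for some `n ≥ 0`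
or `λ = -k_n²` for some `n ≥ 1`, where `k_n` is the unique solution of
`tan (x/2) = -x/2` in `((2n-1)π, (2n+1)π)`. -/
theorem eigenvalues_second_derivative_slow_bond
    (k : ℕ → ℝ)
    (hk : ∀ n : ℕ, 1 ≤ n →
      k n ∈ Set.Ioo ((2 * (n : ℝ) - 1) * Real.pi) ((2 * (n : ℝ) + 1) * Real.pi) ∧
        Real.tan (k n / 2) = -(k n) / 2)
    (G : ℝ → ℝ) (lam : ℝ)
    (hG : ContDiffOn ℝ 2 G (Set.Icc (0 : ℝ) 1))
    (hGne : ∃ u ∈ Set.Icc (0 : ℝ) 1, G u ≠ 0)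
    (heig : ∀ u ∈ Set.Icc (0 : ℝ) 1,
      derivWithin (derivWithin G (Set.Icc (0 : ℝ) 1)) (Set.Icc (0 : ℝ) 1) u = lam * G u)
    (hbc0 : derivWithin G (Set.Icc (0 : ℝ) 1) 0 = G 0 - G 1)
    (hbc1 : derivWithin G (Set.Icc (0 : ℝ) 1) 1 = G 0 - G 1) :
    (∃ n : ℕ, lam = -(2 * (n : ℝ) * Real.pi) ^ 2) ∨
      (∃ n : ℕ, 1 ≤ n ∧ lam = -(k n) ^ 2) := by
  have hU := uniqueDiffOn_Icc (zero_lt_one (α := ℝ))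
  have hG' : ContDiffOn ℝ 1 (derivWithin G (Set.Icc (0 : ℝ) 1)) (Set.Icc 0 1) :=
    hG.derivWithin hU (by norm_num)
  have hH (u : ℝ) (hu : u ∈ Set.Icc (0 : ℝ) 1) :
      HasDerivWithinAt (derivWithin G (Set.Icc (0 : ℝ) 1)) (lam * G u) (Set.Icc 0 1) u :=
    heig u hu ▸ (hG'.differentiableOn one_ne_zero u hu).hasDerivWithinAt
  rcases exists_frequency_of_slow_bond
    (fun u hu ↦ (hG.differentiableOn two_ne_zero u hu).hasDerivWithinAt) hH hGne hbc0 hbc1 with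
    rfl | ⟨w, hw, rfl, h⟩
  · exact Or.inl ⟨0, by simp⟩
  by_cases hsin : Real.sin (w / 2) = 0
  · left
    obtain ⟨m, hm⟩ := Real.sin_eq_zero_iff.1 hsin
    refine ⟨m.natAbs, ?_⟩
    have hcast : ((m.natAbs : ℕ) : ℝ) = |(m : ℝ)| := by rw [Nat.cast_natAbs, Int.cast_abs]
    have hwm : w = 2 * m * Real.pi := by linarith
    rw [hcast, hwm]
    simp only [mul_pow, sq_abs]
  · right
    replace h := h.resolve_left hsin
    have hcos : Real.cos (w / 2) ≠ 0 := fun hc ↦ hsin (by rw [hc] at h; linarith)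
    have htan : Real.tan (w / 2) = -(w / 2) := by
      rw [Real.tan_eq_sin_div_cos, div_eq_iff hcos]
      linarith
    obtain ⟨n, hn, hwn⟩ := exists_branch_of_tan_eq_neg_self (half_pos hw) hcos htan
    obtain ⟨⟨hk1, hk2⟩, hkt⟩ := hk n hn
    have hkn : |k n / 2 - n * Real.pi| < Real.pi / 2 := by
      rw [abs_lt]
      constructor <;> linarith
    have := eq_of_tan_eq_neg_self hwn hkn htan (by rw [hkt, neg_div])
    refine ⟨n, hn, ?_⟩
    rw [show w = k n by linarith]
end

section
/- The functions θ_n, n ∈ ℤ, are pairwise orthogonal in L²([0,1]) with respect to Lebesgue measure: ∫₀¹ θ_m(x) θ_n(x) dx = 0 whenever m ≠ n, and ∫₀¹ θ_n(x)² dx > 0 for every n ∈ ℤ. -/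
open Real

/-- Eigenfunctions of the second derivative with distinct eigenvalues `-a²` and `-b²` are orthogonal
on `[s, t]` as soon as their Wronskian takes the same value at both end points. -/
lemma integral_mul_eq_zero_of_wronskian_eq {f f' g g' : ℝ → ℝ} {a b s t : ℝ}
    (hf : ∀ x, HasDerivAt f (f' x) x) (hf' : ∀ x, HasDerivAt f' (-a ^ 2 * f x) x)
    (hg : ∀ x, HasDerivAt g (g' x) x) (hg' : ∀ x, HasDerivAt g' (-b ^ 2 * g x) x)
    (hab : a ^ 2 ≠ b ^ 2)
    (hW : f' t * g t - f t * g' t = f' s * g s - f s * g' s) :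
    ∫ x in s..t, f x * g x = 0 := by
  have hfc : Continuous f := continuous_iff_continuousAt.2 fun x => (hf x).continuousAt
  have hgc : Continuous g := continuous_iff_continuousAt.2 fun x => (hg x).continuousAt
  have hd : ∀ x, HasDerivAt (fun y => f' y * g y - f y * g' y)
      ((b ^ 2 - a ^ 2) * (f x * g x)) x := fun x =>
    (((hf' x).fun_mul (hg x)).fun_sub ((hf x).fun_mul (hg' x))).congr_deriv (by ring)
  have h := intervalIntegral.integral_eq_sub_of_hasDerivAt (a := s) (b := t) (fun x _ => hd x)
    ((continuous_const.mul (hfc.mul hgc)).intervalIntegrable _ _)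
  rw [intervalIntegral.integral_const_mul, hW, sub_self] at h
  exact (mul_eq_zero.1 h).resolve_left (sub_ne_zero.2 hab.symm)

lemma hasDerivAt_sin_mul_sub (a c x : ℝ) :
    HasDerivAt (fun y => sin (a * (y - c))) (a * cos (a * (x - c))) x :=
  (((hasDerivAt_id x).sub_const c).const_mul a).sin.congr_deriv (by simp; ring)

lemma hasDerivAt_mul_cos_mul_sub (a c x : ℝ) :
    HasDerivAt (fun y => a * cos (a * (y - c))) (-a ^ 2 * sin (a * (x - c))) x :=
  ((((hasDerivAt_id x).sub_const c).const_mul a).cos.const_mul a).congr_deriv (by simp; ring)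

lemma hasDerivAt_cos_mul (a x : ℝ) :
    HasDerivAt (fun y => cos (a * y)) (-a * sin (a * x)) x :=
  ((hasDerivAt_id x).const_mul a).cos.congr_deriv (by simp; ring)

lemma hasDerivAt_neg_mul_sin_mul (a x : ℝ) :
    HasDerivAt (fun y => -a * sin (a * y)) (-a ^ 2 * cos (a * x)) x :=
  (((hasDerivAt_id x).const_mul a).sin.const_mul (-a)).congr_deriv (by simp; ring)

/-- Two distinct frequencies satisfying `sin (a / 2) = -(a / 2) cos (a / 2)` give orthogonal sine
functions centred at `1 / 2`. -/
lemma integral_sin_mul_sin_eq_zero {a b : ℝ} (ha : sin (a / 2) = -a / 2 * cos (a / 2))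
    (hb : sin (b / 2) = -b / 2 * cos (b / 2)) (hab : a ^ 2 ≠ b ^ 2) :
    ∫ x in (0 : ℝ)..1, sin (a * (x - 1 / 2)) * sin (b * (x - 1 / 2)) = 0 := by
  refine integral_mul_eq_zero_of_wronskian_eq (hasDerivAt_sin_mul_sub a _)
    (hasDerivAt_mul_cos_mul_sub a _) (hasDerivAt_sin_mul_sub b _)
    (hasDerivAt_mul_cos_mul_sub b _) hab ?_
  have h1 : ∀ u : ℝ, u * (1 - 1 / 2) = u / 2 := fun u => by ring
  have h0 : ∀ u : ℝ, u * (0 - 1 / 2) = -(u / 2) := fun u => by ring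
  simp only [h1, h0, sin_neg, cos_neg, ha, hb]
  ring

lemma integral_cos_mul_cos_eq_zero {p q : ℕ} (hpq : p ≠ q) :
    ∫ x in (0 : ℝ)..1, cos (2 * p * π * x) * cos (2 * q * π * x) = 0 := by
  have hsin : ∀ r : ℕ, sin (2 * r * π) = 0 := fun r => by
    have h := sin_nat_mul_pi (2 * r)
    push_cast at h
    exact h
  refine integral_mul_eq_zero_of_wronskian_eq (hasDerivAt_cos_mul _)
    (hasDerivAt_neg_mul_sin_mul _) (hasDerivAt_cos_mul _) (hasDerivAt_neg_mul_sin_mul _) ?_ ?_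
  · rw [Ne, sq_eq_sq₀ (by positivity) (by positivity)]
    simpa [pi_ne_zero] using hpq
  · simp [hsin]

lemma integral_sin_mul_cos_eq_zero (a : ℝ) (q : ℕ) :
    ∫ x in (0 : ℝ)..1, sin (a * (x - 1 / 2)) * cos (2 * q * π * x) = 0 := by
  have h := intervalIntegral.integral_comp_sub_left (a := 0) (b := 1)
    (fun x : ℝ => sin (a * (x - 1 / 2)) * cos (2 * q * π * x)) 1
  have hodd : ∀ x : ℝ, sin (a * (1 - x - 1 / 2)) * cos (2 * q * π * (1 - x)) =
      -(sin (a * (x - 1 / 2)) * cos (2 * q * π * x)) := fun x => by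
    rw [show a * (1 - x - 1 / 2) = -(a * (x - 1 / 2)) by ring,
      show 2 * q * π * (1 - x) = q * (2 * π) - 2 * q * π * x by ring, sin_neg,
      cos_nat_mul_two_pi_sub, neg_mul]
  simp only [hodd, intervalIntegral.integral_neg, sub_self, sub_zero] at h
  linarith

lemma theta_natCast_add_one (k : ℕ → ℝ) (n : ℕ) :
    theta k (n + 1 : ℕ) = fun x => sin (k (n + 1) * (x - 1 / 2)) := by
  simp [theta]

lemma theta_neg_natCast (k : ℕ → ℝ) (n : ℕ) :
    theta k (-(n : ℤ)) = fun x => cos (2 * n * π * x) := by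
  have h : ¬(1 : ℤ) ≤ -(n : ℤ) := by omega
  simp [theta, h]

lemma exists_eq_natCast_add_one_or_eq_neg_natCast (n : ℤ) :
    (∃ p : ℕ, n = (p + 1 : ℕ)) ∨ ∃ p : ℕ, n = -(p : ℤ) := by
  rcases le_or_gt n 0 with h | h
  · exact .inr ⟨n.natAbs, by omega⟩
  · exact .inl ⟨n.natAbs - 1, by omega⟩

/-- The functions `θ_n`, `n ∈ ℤ`, are pairwise orthogonal in `L²([0,1])`, and each has
strictly positive `L²`-norm. -/
theorem theta_pairwise_orthogonal
    (k : ℕ → ℝ)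
    (hk : ∀ n : ℕ, 1 ≤ n →
      k n ∈ Set.Ioo ((2 * (n : ℝ) - 1) * Real.pi) ((2 * (n : ℝ) + 1) * Real.pi) ∧
        Real.tan (k n / 2) = -(k n) / 2) :
    (∀ m n : ℤ, m ≠ n → ∫ x in (0 : ℝ)..1, theta k m x * theta k n x = 0) ∧
      (∀ n : ℤ, 0 < ∫ x in (0 : ℝ)..1, (theta k n x) ^ 2) := by
  have hcos : ∀ n : ℕ, 1 ≤ n → cos (k n / 2) ≠ 0 := by
    intro n hn h0
    obtain ⟨⟨hl, hr⟩, ht⟩ := hk n hn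
    rw [tan_eq_sin_div_cos, h0, div_zero] at ht
    have h1 : (1 : ℝ) ≤ n := by exact_mod_cast hn
    nlinarith [pi_pos]
  have hsin : ∀ n : ℕ, 1 ≤ n → sin (k n / 2) = -k n / 2 * cos (k n / 2) := fun n hn => by
    rw [← (hk n hn).2, tan_mul_cos (hcos n hn)]
  have hpos : ∀ n : ℕ, 1 ≤ n → 0 < k n := by
    intro n hn
    have h1 : (1 : ℝ) ≤ n := by exact_mod_cast hn
    nlinarith [pi_pos, (hk n hn).1.1]
  have hlt : ∀ p q : ℕ, 1 ≤ p → p < q → k p < k q := by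
    intro p q hp hpq
    have h1 : (p : ℝ) + 1 ≤ q := by exact_mod_cast hpq
    nlinarith [pi_pos, (hk p hp).1.2, (hk q (hp.trans hpq.le)).1.1]
  have hne : ∀ p q : ℕ, 1 ≤ p → 1 ≤ q → p ≠ q → k p ^ 2 ≠ k q ^ 2 := by
    intro p q hp hq hpq
    rw [Ne, sq_eq_sq₀ (hpos p hp).le (hpos q hq).le]
    rcases hpq.lt_or_gt with h | h
    · exact (hlt p q hp h).ne
    · exact (hlt q p hq h).ne'
  refine ⟨fun m n hmn => ?_, fun n => ?_⟩
  · rcases exists_eq_natCast_add_one_or_eq_neg_natCast m with ⟨p, rfl⟩ | ⟨p, rfl⟩ <;>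
      rcases exists_eq_natCast_add_one_or_eq_neg_natCast n with ⟨q, rfl⟩ | ⟨q, rfl⟩ <;>
      simp only [theta_natCast_add_one, theta_neg_natCast]
    · exact integral_sin_mul_sin_eq_zero (hsin _ (by omega)) (hsin _ (by omega))
        (hne _ _ (by omega) (by omega) (by omega))
    · exact integral_sin_mul_cos_eq_zero _ q
    · simpa only [mul_comm] using integral_sin_mul_cos_eq_zero (k (q + 1)) p
    · exact integral_cos_mul_cos_eq_zero (by omega)
  · suffices h : Continuous (theta k n) ∧ theta k n 0 ≠ 0 from
      intervalIntegral.integral_pos one_pos (h.1.pow 2).continuousOn (fun x _ => sq_nonneg _)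
        ⟨0, by simp, sq_pos_of_ne_zero h.2⟩
    rcases exists_eq_natCast_add_one_or_eq_neg_natCast n with ⟨p, rfl⟩ | ⟨p, rfl⟩
    · rw [theta_natCast_add_one]
      refine ⟨by fun_prop, ?_⟩
      have hp : 1 ≤ p + 1 := by omega
      beta_reduce
      rw [show k (p + 1) * (0 - 1 / 2) = -(k (p + 1) / 2) by ring, sin_neg, hsin _ hp]
      simpa using ⟨(hpos _ hp).ne', hcos _ hp⟩
    · rw [theta_neg_natCast]
      exact ⟨by fun_prop, by simp⟩
end

section
/- The family {θ_n : n ∈ ℤ} is an orthogonal basis of L²([0,1]): the functions θ_n are pairwise orthogonal in L²([0,1]), each has strictly positive L²-norm, and the closure of their linear span is all of L²([0,1]). -/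
open MeasureTheory

open Set

lemma memLp_two_of_continuous {f : ℝ → ℝ} (hf : Continuous f) :
    MemLp f 2 (volume.restrict (Icc (0 : ℝ) 1)) := by
  obtain ⟨C, hC⟩ := isCompact_Icc.exists_bound_of_continuousOn hf.continuousOn
  refine MemLp.of_bound hf.aestronglyMeasurable C ?_
  filter_upwards [ae_restrict_mem measurableSet_Icc] with x hx using hC x hx

/-- The class in `L²([0,1])` of a continuous function on `ℝ`. -/
noncomputable def contToL2 : C(ℝ, ℝ) →ₗ[ℝ] Lp ℝ 2 (volume.restrict (Icc (0 : ℝ) 1)) where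
  toFun f := MemLp.toLp f (memLp_two_of_continuous f.continuous)
  map_add' _ _ := rfl
  map_smul' _ _ := rfl

lemma coeFn_contToL2 (f : C(ℝ, ℝ)) :
    (contToL2 f : ℝ → ℝ) =ᵐ[volume.restrict (Icc (0 : ℝ) 1)] f :=
  MemLp.coeFn_toLp (memLp_two_of_continuous f.continuous)

lemma inner_contToL2 (f g : C(ℝ, ℝ)) :
    inner (𝕜 := ℝ) (contToL2 f) (contToL2 g) = ∫ x in (0 : ℝ)..1, f x * g x := by
  rw [L2.inner_def, intervalIntegral.integral_of_le zero_le_one, ← integral_Icc_eq_integral_Ioc]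
  refine integral_congr_ae ?_
  filter_upwards [coeFn_contToL2 f, coeFn_contToL2 g] with x hf hg
  simp [hf, hg, mul_comm]

lemma norm_contToL2_sq (f : C(ℝ, ℝ)) :
    ‖contToL2 f‖ ^ 2 = ∫ x in (0 : ℝ)..1, f x ^ 2 := by
  rw [← real_inner_self_eq_norm_sq, inner_contToL2]
  simp only [sq]

lemma norm_contToL2_le {f : C(ℝ, ℝ)} {ε : ℝ} (hε : 0 ≤ ε)
    (hf : ∀ x ∈ Icc (0 : ℝ) 1, |f x| ≤ ε) : ‖contToL2 f‖ ≤ ε := by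
  refine le_of_sq_le_sq ?_ hε
  rw [norm_contToL2_sq]
  calc ∫ x in (0 : ℝ)..1, f x ^ 2 ≤ ∫ x in (0 : ℝ)..1, ε ^ 2 := by
        refine intervalIntegral.integral_mono_on zero_le_one
          (Continuous.intervalIntegrable (by fun_prop) _ _)
          (Continuous.intervalIntegrable (by fun_prop) _ _) fun x hx => ?_
        exact sq_le_sq' (neg_le_of_abs_le (hf x hx)) (le_of_abs_le (hf x hx))
    _ = ε ^ 2 := by simp

lemma denseRange_contToL2 : DenseRange contToL2 := by
  refine (BoundedContinuousFunction.toLp_denseRange ℝ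
    (volume.restrict (Icc (0 : ℝ) 1)) ℝ (p := 2) (by simp)).mono ?_
  rintro _ ⟨f, rfl⟩
  exact ⟨f.toContinuousMap, Lp.ext ((coeFn_contToL2 _).trans
    (BoundedContinuousFunction.coeFn_toLp 2 _ ℝ f).symm)⟩

/-- The Neumann eigenfunction `cos (m π x)`. -/
noncomputable def cosPi (m : ℕ) : C(ℝ, ℝ) := ⟨fun x => Real.cos (m * Real.pi * x), by fun_prop⟩

@[simp] lemma cosPi_apply (m : ℕ) (x : ℝ) : cosPi m x = Real.cos (m * Real.pi * x) := rfl

lemma cosPi_one_pow_mul_mem_span (n m : ℕ) :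
    cosPi 1 ^ n * cosPi m ∈ Submodule.span ℝ (range cosPi) := by
  induction n generalizing m with
  | zero =>
    rw [pow_zero, one_mul]
    exact Submodule.subset_span (mem_range_self m)
  | succ n ih =>
    cases m with
    | zero =>
      have : cosPi 1 ^ (n + 1) * cosPi 0 = cosPi 1 ^ n * cosPi 1 := by
        ext x; simp [pow_succ]
      exact this ▸ ih 1
    | succ m =>
      have : cosPi 1 ^ (n + 1) * cosPi (m + 1) =
          (1 / 2 : ℝ) • (cosPi 1 ^ n * cosPi (m + 2) + cosPi 1 ^ n * cosPi m) := by
        ext x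
        have h1 : ((m + 2 : ℕ) : ℝ) * Real.pi * x =
            ((m + 1 : ℕ) : ℝ) * Real.pi * x + Real.pi * x := by push_cast; ring
        have h2 : (m : ℝ) * Real.pi * x =
            ((m + 1 : ℕ) : ℝ) * Real.pi * x - Real.pi * x := by push_cast; ring
        simp only [ContinuousMap.mul_apply, ContinuousMap.pow_apply, ContinuousMap.smul_apply,
          ContinuousMap.add_apply, cosPi_apply, smul_eq_mul, h1, h2, Real.cos_add, Real.cos_sub,
          Nat.cast_one, one_mul]
        ring
      rw [this]
      exact Submodule.smul_mem _ _ (Submodule.add_mem _ (ih _) (ih _))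

lemma aeval_cosPi_one_mem_span (p : Polynomial ℝ) :
    Polynomial.aeval (cosPi 1) p ∈ Submodule.span ℝ (range cosPi) := by
  induction p using Polynomial.induction_on' with
  | add p q hp hq => simpa using Submodule.add_mem _ hp hq
  | monomial n a =>
    have h : cosPi 1 ^ n = cosPi 1 ^ n * cosPi 0 := by ext x; simp
    rw [Polynomial.aeval_monomial, ← Algebra.smul_def, h]
    exact Submodule.smul_mem _ _ (cosPi_one_pow_mul_mem_span n 0)

lemma exists_mem_span_cosPi_near (g : C(ℝ, ℝ)) {ε : ℝ} (hε : 0 < ε) :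
    ∃ f ∈ Submodule.span ℝ (range cosPi), ∀ x ∈ Icc (0 : ℝ) 1, |(f - g) x| ≤ ε := by
  obtain ⟨p, hp⟩ := exists_polynomial_near_of_continuousOn (-1) 1
    (fun y => g (Real.arccos y / Real.pi)) (by fun_prop) ε hε
  refine ⟨Polynomial.aeval (cosPi 1) p, aeval_cosPi_one_mem_span p, fun x hx => ?_⟩
  have h := hp (Real.cos (Real.pi * x)) ⟨Real.neg_one_le_cos _, Real.cos_le_one _⟩
  rw [Real.arccos_cos (by have := hx.1; positivity)
    (by nlinarith [hx.2, Real.pi_pos]), mul_div_cancel_left₀ _ Real.pi_ne_zero] at h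
  have h2 : (Polynomial.aeval (cosPi 1) p) x = p.eval (Real.cos (Real.pi * x)) := by
    simp
  rw [ContinuousMap.sub_apply, h2]
  exact h.le

lemma eq_zero_of_inner_cosPi_eq_zero {v : Lp ℝ 2 (volume.restrict (Icc (0 : ℝ) 1))}
    (hv : ∀ m, inner (𝕜 := ℝ) v (contToL2 (cosPi m)) = 0) : v = 0 := by
  have hspan : ∀ f ∈ Submodule.span ℝ (range cosPi), inner (𝕜 := ℝ) v (contToL2 f) = 0 := by
    intro f hf
    induction hf using Submodule.span_induction with
    | mem f hf => obtain ⟨m, rfl⟩ := hf; exact hv m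
    | zero => simp
    | add f g _ _ hf hg => rw [map_add, inner_add_right, hf, hg, add_zero]
    | smul a f _ hf => rw [map_smul, inner_smul_right, hf, mul_zero]
  have hcont : ∀ g : C(ℝ, ℝ), inner (𝕜 := ℝ) v (contToL2 g) = 0 := by
    intro g
    by_contra hne
    have hv0 : 0 < ‖v‖ := norm_pos_iff.2 fun h => hne (by simp [h])
    set a := |inner (𝕜 := ℝ) v (contToL2 g)| with ha
    have hpos : 0 < a := abs_pos.2 hne
    obtain ⟨f, hf, hfg⟩ := exists_mem_span_cosPi_near g (ε := a / (2 * ‖v‖)) (by positivity)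
    have h1 : a = |inner (𝕜 := ℝ) v (contToL2 (f - g))| := by
      rw [map_sub, inner_sub_right, hspan f hf, zero_sub, abs_neg]
    have h2 : a ≤ ‖v‖ * (a / (2 * ‖v‖)) := by
      conv_lhs => rw [h1]
      exact (abs_real_inner_le_norm _ _).trans
        (mul_le_mul_of_nonneg_left (norm_contToL2_le (by positivity) hfg) hv0.le)
    have h3 : ‖v‖ * (a / (2 * ‖v‖)) = a / 2 := by field_simp
    linarith
  refine denseRange_contToL2.induction_on (p := fun w => inner (𝕜 := ℝ) v w = 0) v
    (isClosed_eq (by fun_prop) continuous_const) hcont |> inner_self_eq_zero.1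

lemma integral_cos_mul_cos {a b : ℝ} (ha : Real.sin a = 0) (hb : Real.sin b = 0)
    (hab : a ^ 2 ≠ b ^ 2) : ∫ x in (0 : ℝ)..1, Real.cos (a * x) * Real.cos (b * x) = 0 := by
  have h0 : a ^ 2 - b ^ 2 ≠ 0 := sub_ne_zero.2 hab
  have hd : ∀ x : ℝ, HasDerivAt (fun x => (a * (Real.sin (a * x) * Real.cos (b * x)) -
      b * (Real.cos (a * x) * Real.sin (b * x))) / (a ^ 2 - b ^ 2))
      (Real.cos (a * x) * Real.cos (b * x)) x := by
    intro x
    have hl : ∀ c : ℝ, HasDerivAt (fun x => c * x) c x := fun c => by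
      simpa using (hasDerivAt_id x).const_mul c
    convert! (((((hl a).sin.mul (hl b).cos).const_mul a).sub
      (((hl a).cos.mul (hl b).sin).const_mul b)).div_const (a ^ 2 - b ^ 2)) using 1
    field_simp
    ring
  rw [intervalIntegral.integral_eq_sub_of_hasDerivAt (fun x _ => hd x)
    (Continuous.intervalIntegrable (by fun_prop) _ _)]
  simp [ha, hb]

lemma integral_cos_sq_of_sin_eq_zero {a : ℝ} (ha : Real.sin a = 0) (h0 : a ≠ 0) :
    ∫ x in (0 : ℝ)..1, Real.cos (a * x) ^ 2 = 1 / 2 := by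
  have hd : ∀ x : ℝ, HasDerivAt (fun x => x / 2 +
      Real.sin (a * x) * Real.cos (a * x) / (2 * a)) (Real.cos (a * x) ^ 2) x := by
    intro x
    have hl : HasDerivAt (fun x => a * x) a x := by
      simpa using (hasDerivAt_id x).const_mul a
    convert! ((hasDerivAt_id x).div_const 2).add ((hl.sin.mul hl.cos).div_const (2 * a)) using 1
    field_simp
    linarith [Real.sin_sq_add_cos_sq (a * x)]
  rw [intervalIntegral.integral_eq_sub_of_hasDerivAt (fun x _ => hd x)
    (Continuous.intervalIntegrable (by fun_prop) _ _)]
  simp [ha]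

lemma integral_sin_mul_sin {a b : ℝ}
    (ha : Real.sin (a / 2) = -a / 2 * Real.cos (a / 2))
    (hb : Real.sin (b / 2) = -b / 2 * Real.cos (b / 2)) (hab : a ^ 2 ≠ b ^ 2) :
    ∫ x in (0 : ℝ)..1, Real.sin (a * (x - 1 / 2)) * Real.sin (b * (x - 1 / 2)) = 0 := by
  have h0 : a ^ 2 - b ^ 2 ≠ 0 := sub_ne_zero.2 hab
  have hd : ∀ x : ℝ, HasDerivAt (fun x =>
      (b * (Real.sin (a * (x - 1 / 2)) * Real.cos (b * (x - 1 / 2))) -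
      a * (Real.cos (a * (x - 1 / 2)) * Real.sin (b * (x - 1 / 2)))) / (a ^ 2 - b ^ 2))
      (Real.sin (a * (x - 1 / 2)) * Real.sin (b * (x - 1 / 2))) x := by
    intro x
    have hl : ∀ c : ℝ, HasDerivAt (fun x => c * (x - 1 / 2)) c x := fun c => by
      simpa only [id, mul_one] using ((hasDerivAt_id x).sub_const (1 / 2)).const_mul c
    convert! (((((hl a).sin.mul (hl b).cos).const_mul b).sub
      (((hl a).cos.mul (hl b).sin).const_mul a)).div_const (a ^ 2 - b ^ 2)) using 1
    field_simp
    ring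
  rw [intervalIntegral.integral_eq_sub_of_hasDerivAt (fun x _ => hd x)
    (Continuous.intervalIntegrable (by fun_prop) _ _)]
  have e1 : ∀ c : ℝ, c * (1 - 1 / 2) = c / 2 := fun c => by ring
  have e2 : ∀ c : ℝ, c * (0 - 1 / 2) = -(c / 2) := fun c => by ring
  simp only [e1, e2, Real.sin_neg, Real.cos_neg, ha, hb]
  ring

lemma integral_sin_mul_cos (a : ℝ) (j : ℕ) :
    ∫ x in (0 : ℝ)..1, Real.sin (a * (x - 1 / 2)) * Real.cos (2 * j * Real.pi * x) = 0 := by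
  have h := intervalIntegral.integral_comp_sub_left (a := 0) (b := 1)
    (fun x => Real.sin (a * (x - 1 / 2)) * Real.cos (2 * j * Real.pi * x)) 1
  have e : ∀ x : ℝ, Real.sin (a * (1 - x - 1 / 2)) * Real.cos (2 * j * Real.pi * (1 - x)) =
      -(Real.sin (a * (x - 1 / 2)) * Real.cos (2 * j * Real.pi * x)) := by
    intro x
    rw [show a * (1 - x - 1 / 2) = -(a * (x - 1 / 2)) by ring, Real.sin_neg,
      show 2 * j * Real.pi * (1 - x) = j * (2 * Real.pi) - 2 * j * Real.pi * x by ring,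
      Real.cos_nat_mul_two_pi_sub]
    ring
  simp only [e, intervalIntegral.integral_neg, sub_self, sub_zero] at h
  linarith

lemma inner_cosPi_of_ne {m n : ℕ} (h : m ≠ n) :
    inner (𝕜 := ℝ) (contToL2 (cosPi m)) (contToL2 (cosPi n)) = 0 := by
  rw [inner_contToL2]
  refine integral_cos_mul_cos (Real.sin_nat_mul_pi m) (Real.sin_nat_mul_pi n) fun he => h ?_
  have h' := (sq_eq_sq₀ (by positivity) (by positivity)).1 he
  exact_mod_cast mul_right_cancel₀ Real.pi_ne_zero h'

lemma norm_cosPi_sq {m : ℕ} (hm : m ≠ 0) : ‖contToL2 (cosPi m)‖ ^ 2 = 1 / 2 := by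
  rw [norm_contToL2_sq]
  exact integral_cos_sq_of_sin_eq_zero (Real.sin_nat_mul_pi m)
    (mul_ne_zero (Nat.cast_ne_zero.2 hm) Real.pi_ne_zero)

lemma norm_contToL2_pos {f : C(ℝ, ℝ)} (hf : f 0 ≠ 0) : 0 < ‖contToL2 f‖ := by
  refine lt_of_pow_lt_pow_left₀ 2 (norm_nonneg _) ?_
  rw [norm_contToL2_sq, zero_pow two_ne_zero]
  exact intervalIntegral.integral_pos zero_lt_one
    (Continuous.continuousOn (by fun_prop)) (fun x _ => sq_nonneg _)
    ⟨0, ⟨le_rfl, zero_le_one⟩, by positivity⟩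

/-- The normalised cosines form a Hilbert basis of `L²([0,1])`. -/
lemma exists_hilbertBasis_cosPi :
    ∃ e : HilbertBasis ℕ ℝ (Lp ℝ 2 (volume.restrict (Icc (0 : ℝ) 1))),
      ∀ m, e m = ‖contToL2 (cosPi m)‖⁻¹ • contToL2 (cosPi m) := by
  have hpos : ∀ m, 0 < ‖contToL2 (cosPi m)‖ := fun m => norm_contToL2_pos (by simp)
  have hon : Orthonormal ℝ fun m => ‖contToL2 (cosPi m)‖⁻¹ • contToL2 (cosPi m) := by
    refine ⟨fun m => ?_, fun m n h => ?_⟩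
    · rw [norm_smul, norm_inv, norm_norm, inv_mul_cancel₀ (hpos m).ne']
    · change inner (𝕜 := ℝ) (_ • _) (_ • _) = 0
      rw [inner_smul_left, inner_smul_right, inner_cosPi_of_ne h, mul_zero, mul_zero]
  have hbot : (Submodule.span ℝ
      (range fun m => ‖contToL2 (cosPi m)‖⁻¹ • contToL2 (cosPi m)))ᗮ = ⊥ := by
    refine (Submodule.eq_bot_iff _).2 fun v hv => eq_zero_of_inner_cosPi_eq_zero fun m => ?_
    have h := (Submodule.mem_orthogonal' _ _).1 hv _ (Submodule.subset_span (mem_range_self m))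
    rw [inner_smul_right] at h
    exact (mul_eq_zero.1 h).resolve_left (inv_pos.2 (hpos m)).ne'
  exact ⟨HilbertBasis.mkOfOrthogonalEqBot hon hbot, fun m => by
    rw [HilbertBasis.coe_mkOfOrthogonalEqBot]⟩

lemma eq_zero_of_inner_cosPi_sq_le {v : Lp ℝ 2 (volume.restrict (Icc (0 : ℝ) 1))}
    (hv : ∀ m : ℕ, inner (𝕜 := ℝ) v (contToL2 (cosPi m)) ^ 2 ≤
      ‖v‖ ^ 2 * (4 / (3 * Real.pi ^ 2)) * (1 / (m : ℝ) ^ 2)) : v = 0 := by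
  obtain ⟨e, he⟩ := exists_hilbertBasis_cosPi
  have hs := e.hasSum_inner_mul_inner v v
  have hz := hasSum_zeta_two.mul_left (‖v‖ ^ 2 * (8 / (3 * Real.pi ^ 2)))
  have hle := hasSum_le (fun m => ?_) hs hz
  · rw [real_inner_self_eq_norm_sq] at hle
    have h : ‖v‖ ^ 2 * (8 / (3 * Real.pi ^ 2)) * (Real.pi ^ 2 / 6) = ‖v‖ ^ 2 * (4 / 9) := by
      have := Real.pi_ne_zero
      field_simp
      ring
    exact norm_eq_zero.1 (pow_eq_zero_iff two_ne_zero |>.1 (by nlinarith [sq_nonneg ‖v‖]))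
  · have hm := hv m
    rw [real_inner_comm, he, inner_smul_left]
    simp only [conj_trivial]
    rw [real_inner_comm]
    rcases eq_or_ne m 0 with rfl | h0
    · have : inner (𝕜 := ℝ) v (contToL2 (cosPi 0)) = 0 := by
        refine pow_eq_zero_iff two_ne_zero |>.1 (le_antisymm ?_ (sq_nonneg _))
        simpa using hm
      simp [this]
    · have h2 : (‖contToL2 (cosPi m)‖⁻¹) ^ 2 = 2 := by
        rw [inv_pow, norm_cosPi_sq h0]; norm_num
      calc _ = (‖contToL2 (cosPi m)‖⁻¹) ^ 2 * inner (𝕜 := ℝ) v (contToL2 (cosPi m)) ^ 2 := by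
            ring
        _ ≤ 2 * (‖v‖ ^ 2 * (4 / (3 * Real.pi ^ 2)) * (1 / (m : ℝ) ^ 2)) := by
            rw [h2]; gcongr
        _ = _ := by ring

/-- The shifted sine `sin (a (x - 1/2))`. -/
noncomputable def shiftedSin (a : ℝ) : C(ℝ, ℝ) :=
  ⟨fun x => Real.sin (a * (x - 1 / 2)), by fun_prop⟩

@[simp] lemma shiftedSin_apply (a x : ℝ) : shiftedSin a x = Real.sin (a * (x - 1 / 2)) := rfl

lemma cosPi_odd_eq (j : ℕ) :
    cosPi (2 * j + 1) = (-(-1) ^ j : ℝ) • shiftedSin ((2 * j + 1) * Real.pi) := by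
  ext x
  have h : (2 * j + 1) * Real.pi * (x - 1 / 2) =
      (((2 * j + 1 : ℕ) : ℝ) * Real.pi * x - j * Real.pi) - Real.pi / 2 := by push_cast; ring
  have hs : ((-1 : ℝ) ^ j) * (-1) ^ j = 1 := by rw [← mul_pow]; simp
  rw [ContinuousMap.smul_apply, shiftedSin_apply, h, Real.sin_sub_pi_div_two,
    Real.cos_sub_nat_mul_pi, cosPi_apply, smul_eq_mul]
  linear_combination (-Real.cos (((2 * j + 1 : ℕ) : ℝ) * Real.pi * x)) * hs

lemma norm_shiftedSin_sub_sq_le (a b : ℝ) :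
    ‖contToL2 (shiftedSin a - shiftedSin b)‖ ^ 2 ≤ (a - b) ^ 2 / 12 := by
  rw [norm_contToL2_sq]
  calc ∫ x in (0 : ℝ)..1, (shiftedSin a - shiftedSin b) x ^ 2
      ≤ ∫ x in (0 : ℝ)..1, (a - b) ^ 2 * (x - 1 / 2) ^ 2 := by
        refine intervalIntegral.integral_mono_on zero_le_one
          (Continuous.intervalIntegrable (by fun_prop) _ _)
          (Continuous.intervalIntegrable (by fun_prop) _ _) fun x _ => ?_
        rw [← mul_pow, sub_mul]
        exact sq_le_sq.2 (Real.abs_sin_sub_sin_le _ _)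
    _ = (a - b) ^ 2 / 12 := by
        rw [intervalIntegral.integral_const_mul,
          intervalIntegral.integral_comp_sub_right (fun x => x ^ 2) (1 / 2 : ℝ), integral_pow]
        norm_num
        ring

lemma sin_half_eq_of_tan_half_eq {a : ℝ} (h0 : a ≠ 0) (h : Real.tan (a / 2) = -a / 2) :
    Real.sin (a / 2) = -a / 2 * Real.cos (a / 2) := by
  have hc : Real.cos (a / 2) ≠ 0 := fun hc => h0 (by
    rw [Real.tan_eq_sin_div_cos, hc, div_zero] at h; linarith)
  rw [← h, Real.tan_mul_cos hc]

lemma sub_sq_le_of_tan_half_eq {a : ℝ} {j : ℕ}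
    (ha : a ∈ Ioo ((2 * j + 1) * Real.pi) ((2 * j + 3) * Real.pi))
    (h : Real.tan (a / 2) = -a / 2) :
    ((2 * j + 1) * Real.pi - a) ^ 2 ≤ 16 / (((2 * j + 1 : ℕ) : ℝ) ^ 2 * Real.pi ^ 2) := by
  have hb : 0 < (2 * (j : ℝ) + 1) * Real.pi := by positivity
  have ha0 : 0 < a := hb.trans ha.1
  have hsin := sin_half_eq_of_tan_half_eq ha0.ne' h
  obtain ⟨d, hd⟩ : ∃ d, d = a / 2 - (2 * j + 1) * Real.pi / 2 := ⟨_, rfl⟩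
  have hd0 : 0 < d := by linarith [ha.1]
  have hdpi : d < Real.pi := by linarith [ha.2]
  have he : a / 2 = d + Real.pi / 2 + j * Real.pi := by rw [hd]; ring
  have hcos : Real.cos d = a / 2 * Real.sin d := by
    have hne : ((-1 : ℝ) ^ j) ≠ 0 := by positivity
    rw [neg_div, he, Real.sin_add_nat_mul_pi, Real.cos_add_nat_mul_pi, Real.sin_add_pi_div_two,
      Real.cos_add_pi_div_two, ← he] at hsin
    refine mul_left_cancel₀ hne ?_
    linear_combination hsin
  have hs : 0 < Real.sin d := Real.sin_pos_of_pos_of_lt_pi hd0 hdpi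
  have hc : 0 < Real.cos d := by rw [hcos]; positivity
  have hd2 : d < Real.pi / 2 := by
    by_contra! hge
    exact hc.not_ge (Real.cos_nonpos_of_pi_div_two_le_of_le hge (by linarith))
  have hmul : d * (a / 2) < 1 := by
    have hlt := Real.lt_tan hd0 hd2
    rw [Real.tan_eq_sin_div_cos, lt_div_iff₀ hc, hcos] at hlt
    nlinarith
  have hmul2 : d * ((2 * j + 1) * Real.pi) ≤ 2 := by nlinarith [ha.1]
  rw [le_div_iff₀ (by positivity)]
  push_cast
  calc ((2 * j + 1) * Real.pi - a) ^ 2 * ((2 * j + 1 : ℝ) ^ 2 * Real.pi ^ 2)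
      = 4 * (d * ((2 * j + 1) * Real.pi)) ^ 2 := by rw [hd]; ring
    _ ≤ 4 * 2 ^ 2 := by gcongr
    _ = 16 := by norm_num

/-- The family `{θ_n : n ∈ ℤ}` is an orthogonal basis of `L²([0,1])`: the `θ_n` are
pairwise orthogonal, each has strictly positive norm, and the closure of their span is
all of `L²([0,1])`. -/
theorem theta_orthogonal_basis
    (k : ℕ → ℝ)
    (hk : ∀ n : ℕ, 1 ≤ n →
      k n ∈ Set.Ioo ((2 * (n : ℝ) - 1) * Real.pi) ((2 * (n : ℝ) + 1) * Real.pi) ∧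
        Real.tan (k n / 2) = -(k n) / 2)
    (Theta : ℤ → Lp ℝ 2 (volume.restrict (Set.Icc (0 : ℝ) 1)))
    (hTheta : ∀ n : ℤ,
      (Theta n : ℝ → ℝ) =ᵐ[volume.restrict (Set.Icc (0 : ℝ) 1)] theta k n) :
    (∀ m n : ℤ, m ≠ n → inner (𝕜 := ℝ) (Theta m) (Theta n) = 0) ∧
      (∀ n : ℤ, 0 < ‖Theta n‖) ∧
      (Submodule.span ℝ (Set.range Theta)).topologicalClosure = ⊤ := by
  have hsinTheta : ∀ j : ℕ, Theta (j + 1) = contToL2 (shiftedSin (k (j + 1))) := by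
    intro j
    refine Lp.ext ((hTheta _).trans (Filter.EventuallyEq.trans (.of_eq ?_)
      (coeFn_contToL2 _).symm))
    have h : ((j : ℤ) + 1).toNat = j + 1 := by omega
    ext x
    simp [theta, h]
  have hcosTheta : ∀ j : ℕ, Theta (-j) = contToL2 (cosPi (2 * j)) := by
    intro j
    refine Lp.ext ((hTheta _).trans (Filter.EventuallyEq.trans (.of_eq ?_)
      (coeFn_contToL2 _).symm))
    have h : ¬ (1 : ℤ) ≤ -j := by omega
    ext x
    simp [theta, h]
  have hcases : ∀ n : ℤ, (∃ j : ℕ, n = j + 1) ∨ ∃ j : ℕ, n = -j := by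
    intro n
    rcases lt_or_ge 0 n with h | h
    · exact Or.inl ⟨(n - 1).toNat, by omega⟩
    · exact Or.inr ⟨(-n).toNat, by omega⟩
  have hmem : ∀ j : ℕ, k (j + 1) ∈ Ioo ((2 * j + 1) * Real.pi) ((2 * j + 3) * Real.pi) := by
    intro j
    have h := (hk (j + 1) (by omega)).1
    push_cast at h
    convert! h using 2 <;> ring
  have htan : ∀ j : ℕ, Real.tan (k (j + 1) / 2) = -k (j + 1) / 2 :=
    fun j => (hk (j + 1) (by omega)).2
  have hpos : ∀ j : ℕ, 0 < k (j + 1) := fun j => lt_trans (by positivity) (hmem j).1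
  have hsin := fun j => sin_half_eq_of_tan_half_eq (hpos j).ne' (htan j)
  have hlt : ∀ i j : ℕ, i < j → k (i + 1) < k (j + 1) := by
    intro i j hij
    have : (i : ℝ) + 1 ≤ j := by exact_mod_cast hij
    exact (hmem i).2.trans_le (le_trans
      (mul_le_mul_of_nonneg_right (by linarith) Real.pi_pos.le) (hmem j).1.le)
  have hsc : ∀ i j : ℕ, inner (𝕜 := ℝ) (Theta (i + 1)) (Theta (-j)) = 0 := by
    intro i j
    rw [hsinTheta, hcosTheta, inner_contToL2]
    simpa using integral_sin_mul_cos (k (i + 1)) j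
  refine ⟨fun m n hmn => ?_, fun n => ?_, ?_⟩
  · rcases hcases m with ⟨i, rfl⟩ | ⟨i, rfl⟩ <;> rcases hcases n with ⟨j, rfl⟩ | ⟨j, rfl⟩
    · rw [hsinTheta, hsinTheta, inner_contToL2]
      refine integral_sin_mul_sin (hsin i) (hsin j) fun h => ?_
      have h' := (sq_eq_sq₀ (hpos i).le (hpos j).le).1 h
      rcases lt_trichotomy i j with hij | rfl | hij
      · exact (hlt i j hij).ne h'
      · exact hmn rfl
      · exact (hlt j i hij).ne' h'
    · exact hsc i j
    · rw [real_inner_comm]; exact hsc j i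
    · rw [hcosTheta, hcosTheta]
      exact inner_cosPi_of_ne fun h => hmn (by omega)
  · rcases hcases n with ⟨j, rfl⟩ | ⟨j, rfl⟩
    · rw [hsinTheta]
      refine norm_contToL2_pos fun h => ?_
      have h1 : k (j + 1) * (0 - 1 / 2) = -(k (j + 1) / 2) := by ring
      rw [shiftedSin_apply, h1, Real.sin_neg, neg_eq_zero] at h
      have h2 : Real.cos (k (j + 1) / 2) = 0 := by
        have := hsin j
        rw [h, eq_comm] at this
        exact (mul_eq_zero.1 this).resolve_left (by linarith [hpos j])
      have := Real.sin_sq_add_cos_sq (k (j + 1) / 2)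
      rw [h, h2] at this
      norm_num at this
    · rw [hcosTheta]
      exact norm_contToL2_pos (by simp)
  · rw [Submodule.topologicalClosure_eq_top_iff, Submodule.eq_bot_iff]
    intro v hv
    have hv' : ∀ n, inner (𝕜 := ℝ) v (Theta n) = 0 := fun n =>
      (Submodule.mem_orthogonal' _ _).1 hv _ (Submodule.subset_span (mem_range_self n))
    refine eq_zero_of_inner_cosPi_sq_le fun m => ?_
    obtain ⟨j, rfl | rfl⟩ := Nat.even_or_odd' m
    · rw [← hcosTheta, hv', zero_pow two_ne_zero]
      positivity
    · have hS : inner (𝕜 := ℝ) v (contToL2 (shiftedSin ((2 * j + 1) * Real.pi))) =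
          inner (𝕜 := ℝ) v (contToL2 (shiftedSin ((2 * j + 1) * Real.pi) -
            shiftedSin (k (j + 1)))) := by
        rw [map_sub, inner_sub_right, ← hsinTheta, hv', sub_zero]
      have hone : ((-(-1) ^ j : ℝ)) ^ 2 = 1 := by rw [neg_sq, ← pow_mul, mul_comm, pow_mul]; simp
      rw [cosPi_odd_eq, map_smul, inner_smul_right, mul_pow, hone, one_mul, hS]
      calc _ ≤ (‖v‖ * ‖contToL2 (shiftedSin ((2 * j + 1) * Real.pi) -
              shiftedSin (k (j + 1)))‖) ^ 2 := by
            rw [← sq_abs]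
            gcongr
            exact abs_real_inner_le_norm _ _
        _ ≤ ‖v‖ ^ 2 * (16 / (((2 * j + 1 : ℕ) : ℝ) ^ 2 * Real.pi ^ 2) / 12) := by
            rw [mul_pow]
            gcongr
            refine (norm_shiftedSin_sub_sq_le _ _).trans ?_
            gcongr
            exact sub_sq_le_of_tan_half_eq (hmem j) (htan j)
        _ = _ := by
            have := Real.pi_ne_zero
            field_simp
            ring
end

section
/- Fix ρ ∈ (0,1), a continuous function φ : [0,1] → ℝ, and positive reals (a_N) with lim_{N→∞} a_N/N = 0 and lim_{N→∞} N/a_N² = 0. For N large enough that ρ + (a_N/N) φ(x/N) ∈ (0,1) for every x ∈ {0, …, N−1}, let ν_{N,φ} be the product probability measure on {0,1}^{{0,…,N−1}} under which the coordinate at site x equals 1 with probability ρ + (a_N/N) φ(x/N), and let ν_ρ be the product measure under which every coordinate equals 1 with probability ρ. Then, with η distributed according to ν_{N,φ}, the random variables (N/a_N²) · log( (dν_ρ/dν_{N,φ})(η) ) converge in probability, as N → ∞, to −(1/(2ρ(1−ρ))) ∫₀¹ φ(u)² du. -/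
open MeasureTheory Filter

/-- The log-likelihood ratio, at a single site, of a Bernoulli variable of parameter `ρ`
with respect to one of parameter `ρ + ε`. -/
noncomputable def bernoulliLogRatio (ρ ε : ℝ) (b : Bool) : ℝ :=
  Real.log (if b then ρ / (ρ + ε) else (1 - ρ) / (1 - ρ - ε))

/-- The mean of `bernoulliLogRatio ρ ε` under the Bernoulli law of parameter `ρ + ε`. -/
noncomputable def bernoulliLogRatioMean (ρ ε : ℝ) : ℝ :=
  (ρ + ε) * bernoulliLogRatio ρ ε true + (1 - ρ - ε) * bernoulliLogRatio ρ ε false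

theorem abs_log_one_add_le {t : ℝ} (ht : |t| ≤ 1 / 2) : |Real.log (1 + t)| ≤ 2 * |t| := by
  have h := Real.abs_log_sub_add_sum_range_le (x := -t) (by rw [abs_neg]; linarith) 0
  simp only [Finset.range_zero, Finset.sum_empty, zero_add, sub_neg_eq_add, abs_neg,
    pow_one] at h
  refine h.trans ((div_le_iff₀ (by linarith)).2 ?_)
  nlinarith [abs_nonneg t]

theorem abs_log_one_add_sub_quadratic_le {t : ℝ} (ht : |t| ≤ 1 / 2) :
    |Real.log (1 + t) - (t - t ^ 2 / 2)| ≤ 2 * |t| ^ 3 := by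
  have h := Real.abs_log_sub_add_sum_range_le (x := -t) (by rw [abs_neg]; linarith) 2
  simp only [Finset.sum_range_succ, Finset.range_zero, Finset.sum_empty, sub_neg_eq_add,
    abs_neg] at h
  have e : Real.log (1 + t) - (t - t ^ 2 / 2) =
      0 + (-t) ^ (0 + 1) / ((0 : ℕ) + 1) + (-t) ^ (1 + 1) / ((1 : ℕ) + 1) + Real.log (1 + t) := by
    push_cast; ring
  rw [e]
  refine h.trans ((div_le_iff₀ (by linarith)).2 ?_)
  calc |t| ^ 3 = 2 * |t| ^ 3 * (1 - 1 / 2) := by ring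
    _ ≤ 2 * |t| ^ 3 * (1 - |t|) := by gcongr

theorem bernoulliLogRatio_true {ρ ε : ℝ} (hρ : 0 < ρ) :
    bernoulliLogRatio ρ ε true = -Real.log (1 + ε / ρ) := by
  rw [bernoulliLogRatio, if_pos rfl, ← Real.log_inv]
  congr 1
  rw [one_add_div hρ.ne', inv_div]

theorem bernoulliLogRatio_false {ρ ε : ℝ} (hρ : ρ < 1) :
    bernoulliLogRatio ρ ε false = -Real.log (1 + -ε / (1 - ρ)) := by
  rw [bernoulliLogRatio, if_neg (by simp), ← Real.log_inv]
  congr 1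
  rw [one_add_div (sub_pos.2 hρ).ne', inv_div, sub_eq_add_neg (1 - ρ)]

theorem exists_abs_bernoulliLogRatio_le {ρ : ℝ} (hρ : ρ ∈ Set.Ioo (0 : ℝ) 1) :
    ∃ C > 0, ∃ r > 0, ∀ ε : ℝ, |ε| ≤ r → (∀ b, |bernoulliLogRatio ρ ε b| ≤ C * |ε|) ∧
      |bernoulliLogRatioMean ρ ε + ε ^ 2 / (2 * ρ * (1 - ρ))| ≤ C * |ε| ^ 3 := by
  obtain ⟨h0, h1⟩ := hρ
  obtain ⟨q, rfl⟩ : ∃ q, ρ = 1 - q := ⟨1 - ρ, by ring⟩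
  set p := 1 - q with hp
  have hq : 0 < q := by linarith
  have hpq : 1 - p = q := by rw [hp]; ring
  refine ⟨2 / p + 2 / q + (1 / (2 * p ^ 2) + 1 / (2 * q ^ 2) + 4 / p ^ 3 + 4 / q ^ 3),
    by positivity, min p q / 2, by positivity, fun ε hε => ?_⟩
  have hεp : |ε| ≤ p / 2 := hε.trans (by linarith [min_le_left p q])
  have hεq : |ε| ≤ q / 2 := hε.trans (by linarith [min_le_right p q])
  have hu : |ε / p| = |ε| / p := by rw [abs_div, abs_of_pos h0]
  have hv : |-ε / q| = |ε| / q := by rw [abs_div, abs_neg, abs_of_pos hq]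
  have hu2 : |ε / p| ≤ 1 / 2 := by rw [hu, div_le_iff₀ h0]; linarith
  have hv2 : |-ε / q| ≤ 1 / 2 := by rw [hv, div_le_iff₀ hq]; linarith
  have ht := bernoulliLogRatio_true (ε := ε) h0
  have hf := bernoulliLogRatio_false (ε := ε) h1
  rw [hpq] at hf
  have hA : 0 ≤ 1 / (2 * p ^ 2) + 1 / (2 * q ^ 2) + 4 / p ^ 3 + 4 / q ^ 3 := by positivity
  have hB : 0 ≤ 2 / p := by positivity
  have hC : 0 ≤ 2 / q := by positivity
  refine ⟨fun b => ?_, ?_⟩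
  · cases b
    · rw [hf, abs_neg]
      refine (abs_log_one_add_le hv2).trans ?_
      rw [hv, mul_div_assoc', ← div_mul_eq_mul_div]
      exact mul_le_mul_of_nonneg_right (by linarith) (abs_nonneg ε)
    · rw [ht, abs_neg]
      refine (abs_log_one_add_le hu2).trans ?_
      rw [hu, mul_div_assoc', ← div_mul_eq_mul_div]
      exact mul_le_mul_of_nonneg_right (by linarith) (abs_nonneg ε)
  · have hR := abs_log_one_add_sub_quadratic_le hu2
    have hS := abs_log_one_add_sub_quadratic_le hv2
    set R := Real.log (1 + ε / p) - (ε / p - (ε / p) ^ 2 / 2) with hRdef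
    set S := Real.log (1 + -ε / q) - (-ε / q - (-ε / q) ^ 2 / 2) with hSdef
    rw [hu] at hR
    rw [hv] at hS
    have key : bernoulliLogRatioMean p ε + ε ^ 2 / (2 * p * (1 - p)) =
        ε ^ 3 * (1 / (2 * p ^ 2) - 1 / (2 * q ^ 2)) - (p + ε) * R - (q - ε) * S := by
      rw [bernoulliLogRatioMean, ht, hf, hpq,
        show Real.log (1 + ε / p) = R + (ε / p - (ε / p) ^ 2 / 2) by rw [hRdef]; ring,
        show Real.log (1 + -ε / q) = S + (-ε / q - (-ε / q) ^ 2 / 2) by rw [hSdef]; ring]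
      have hsum : p = 1 - q := hp
      clear_value p R S
      subst hsum
      have := h0.ne'
      field_simp
      ring
    obtain ⟨hε1, hε2⟩ := abs_le.1 hεp
    obtain ⟨hε3, hε4⟩ := abs_le.1 hεq
    have b1 : |ε ^ 3 * (1 / (2 * p ^ 2) - 1 / (2 * q ^ 2))| ≤
        |ε| ^ 3 * (1 / (2 * p ^ 2) + 1 / (2 * q ^ 2)) := by
      rw [abs_mul, abs_pow]
      refine mul_le_mul_of_nonneg_left ?_ (by positivity)
      refine (abs_sub _ _).trans ?_
      rw [abs_of_pos (by positivity), abs_of_pos (by positivity)]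
    have b2 : |(p + ε) * R| ≤ 2 * (2 * (|ε| / p) ^ 3) := by
      rw [abs_mul]
      exact mul_le_mul (abs_le.2 ⟨by linarith, by linarith⟩) hR (abs_nonneg _) (by norm_num)
    have b3 : |(q - ε) * S| ≤ 2 * (2 * (|ε| / q) ^ 3) := by
      rw [abs_mul]
      exact mul_le_mul (abs_le.2 ⟨by linarith, by linarith⟩) hS (abs_nonneg _) (by norm_num)
    rw [key]
    have e : |ε| ^ 3 * (1 / (2 * p ^ 2) + 1 / (2 * q ^ 2)) + 2 * (2 * (|ε| / p) ^ 3) +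
        2 * (2 * (|ε| / q) ^ 3) =
        (1 / (2 * p ^ 2) + 1 / (2 * q ^ 2) + 4 / p ^ 3 + 4 / q ^ 3) * |ε| ^ 3 := by
      rw [div_pow, div_pow]; ring
    have h3 : 0 ≤ |ε| ^ 3 := by positivity
    refine (abs_sub _ _).trans ((add_le_add ((abs_sub _ _).trans (add_le_add b1 b2)) b3).trans ?_)
    rw [e]
    exact mul_le_mul_of_nonneg_right (by linarith) h3

theorem ContinuousOn.tendsto_riemannSum_integral {f : ℝ → ℝ}
    (hf : ContinuousOn f (Set.Icc (0 : ℝ) 1)) :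
    Tendsto (fun N : ℕ => (∑ x : Fin N, f ((x : ℝ) / N)) / N) atTop
      (nhds (∫ u in (0 : ℝ)..1, f u)) := by
  rw [Metric.tendsto_atTop]
  intro e he
  have huc := isCompact_Icc.uniformContinuousOn_of_continuous hf
  rw [Metric.uniformContinuousOn_iff] at huc
  obtain ⟨d, hd, huc⟩ := huc (e / 2) (by positivity)
  obtain ⟨n, hn⟩ := exists_nat_gt (1 / d)
  refine ⟨n + 1, fun N hN => ?_⟩
  have hN0 : (0 : ℝ) < N := by exact_mod_cast (by omega : 0 < N)
  have hNd : 1 / (N : ℝ) < d := by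
    rw [div_lt_comm₀ hN0 hd]
    exact hn.trans (by exact_mod_cast hN)
  have hmem : ∀ k ≤ N, (k : ℝ) / N ∈ Set.Icc (0 : ℝ) 1 := fun k hk =>
    ⟨by positivity, (div_le_one hN0).2 (by exact_mod_cast hk)⟩
  have hint : ∀ k < N, IntervalIntegrable f volume ((k : ℝ) / N) (((k + 1 : ℕ) : ℝ) / N) :=
    fun k hk => (hf.mono (Set.uIcc_subset_Icc (hmem k hk.le)
      (hmem (k + 1) hk))).intervalIntegrable
  have hI := intervalIntegral.sum_integral_adjacent_intervals hint
  rw [Nat.cast_zero, zero_div, div_self hN0.ne'] at hI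
  rw [Fin.sum_univ_eq_sum_range (fun k => f ((k : ℝ) / N)), Finset.sum_div, ← hI,
    Real.dist_eq, ← Finset.sum_sub_distrib]
  have hlen : ∀ k : ℕ, ((k + 1 : ℕ) : ℝ) / N - (k : ℝ) / N = 1 / N := fun k => by
    push_cast; ring
  calc _ ≤ ∑ k ∈ Finset.range N, |f ((k : ℝ) / N) / N -
          ∫ u in ((k : ℝ) / N)..(((k + 1 : ℕ) : ℝ) / N), f u| := Finset.abs_sum_le_sum_abs _ _
    _ ≤ ∑ k ∈ Finset.range N, e / 2 * (1 / N) := by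
        refine Finset.sum_le_sum fun k hk => ?_
        have hk := Finset.mem_range.1 hk
        have hc : f ((k : ℝ) / N) / N =
            ∫ u in ((k : ℝ) / N)..(((k + 1 : ℕ) : ℝ) / N), f ((k : ℝ) / N) := by
          rw [intervalIntegral.integral_const, hlen, smul_eq_mul]; ring
        rw [hc, ← intervalIntegral.integral_sub intervalIntegrable_const (hint k hk)]
        rw [← Real.norm_eq_abs]
        refine (intervalIntegral.norm_integral_le_of_norm_le_const (C := e / 2)
          fun u hu => ?_).trans ?_
        · have hle : (k : ℝ) / N ≤ ((k + 1 : ℕ) : ℝ) / N := by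
            have := hlen k
            have : 0 < 1 / (N : ℝ) := by positivity
            linarith
          rw [Set.uIoc_of_le hle] at hu
          have h1 := hmem k hk.le
          have h2 := hmem (k + 1) hk
          refine (huc _ h1 u ⟨h1.1.trans hu.1.le, hu.2.trans h2.2⟩ ?_).le
          rw [Real.dist_eq, abs_sub_comm, abs_of_pos (sub_pos.2 hu.1)]
          linarith [hlen k, hu.2]
        · rw [hlen, abs_of_pos (by positivity)]
    _ = e / 2 := by
        rw [Finset.sum_const, Finset.card_range, nsmul_eq_mul]
        field_simp
    _ < e := by linarith

open ProbabilityTheory in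
/-- Chebyshev's inequality for a sum of independent functions of Bernoulli variables. -/
theorem measure_bernoulliProduct_le_abs_sum_sub {ι : Type*} [Fintype ι]
    (P : Measure (ι → Bool)) (p : ι → ℝ) (hp : ∀ i, p i ∈ Set.Ioo (0 : ℝ) 1)
    (hP : ∀ η : ι → Bool, P {η} =
      ∏ i, if η i then ENNReal.ofReal (p i) else ENNReal.ofReal (1 - p i))
    (X : ι → Bool → ℝ) (K : ι → ℝ) (hX : ∀ i b, |X i b| ≤ K i) {c : ℝ} (hc : 0 < c) :
    P {η | c ≤ |∑ i, X i (η i) - ∑ i, (p i * X i true + (1 - p i) * X i false)|} ≤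
      ENNReal.ofReal ((∑ i, K i ^ 2) / c ^ 2) := by
  let μ : ι → Measure Bool := fun i =>
    bernoulliMeasure true false ⟨p i, (hp i).1.le, (hp i).2.le⟩
  have hμ : ∀ i, IsProbabilityMeasure (μ i) := fun i => by
    change IsProbabilityMeasure (bernoulliMeasure _ _ _); infer_instance
  have hμint : ∀ i (f : Bool → ℝ), ∫ b, f b ∂μ i = p i * f true + (1 - p i) * f false :=
    fun i f => integral_bernoulliMeasure _ _ _ _
  have hL : ∀ i, MemLp (X i) 2 (μ i) := fun i =>
    MemLp.of_bound (by fun_prop) (K i) (Eventually.of_forall (hX i))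
  have hPμ : P = Measure.pi μ := by
    refine Measure.ext_of_singleton fun η => ?_
    rw [hP, Measure.pi_singleton]
    refine Finset.prod_congr rfl fun i _ => ?_
    cases η i
    · rw [if_neg (by simp)]
      change _ = bernoulliMeasure _ _ _ _
      rw [bernoulliMeasure_apply_of_notMem_of_mem _ (by simp) (by simp) (by simp),
        ENNReal.ofReal, Real.toNNReal_of_nonneg (sub_nonneg.2 (hp i).2.le)]
      rfl
    · rw [if_pos rfl]
      change _ = bernoulliMeasure _ _ _ _
      rw [bernoulliMeasure_apply_of_mem_of_notMem _ (by simp) (by simp) (by simp),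
        ENNReal.ofReal, Real.toNNReal_of_nonneg (hp i).1.le]
      rfl
  have hcomp : ∀ i, MemLp (fun η : ι → Bool => X i (η i)) 2 (Measure.pi μ) := fun i =>
    (hL i).comp_measurePreserving (measurePreserving_eval μ i)
  have hmean : ∫ η, (∑ i, fun η : ι → Bool => X i (η i)) η ∂Measure.pi μ =
      ∑ i, (p i * X i true + (1 - p i) * X i false) := by
    simp only [Finset.sum_apply]
    rw [integral_finsetSum _ fun i _ => (hcomp i).integrable one_le_two]
    refine Finset.sum_congr rfl fun i _ => ?_
    rw [integral_comp_eval (hL i).aestronglyMeasurable, hμint]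
  have hcheb := meas_ge_le_variance_div_sq
    (memLp_finsetSum' Finset.univ fun i _ => hcomp i) hc
  rw [hmean, variance_sum_pi hL] at hcheb
  simp only [Finset.sum_apply] at hcheb
  rw [hPμ]
  refine hcheb.trans (ENNReal.ofReal_le_ofReal ?_)
  gcongr with i _
  refine (variance_le_expectation_sq (hL i).aestronglyMeasurable).trans ?_
  rw [hμint]
  have h1 := sq_le_sq' (neg_le_of_abs_le (hX i true)) (le_of_abs_le (hX i true))
  have h2 := sq_le_sq' (neg_le_of_abs_le (hX i false)) (le_of_abs_le (hX i false))
  have h3 := mul_le_mul_of_nonneg_left h1 (hp i).1.le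
  have h4 := mul_le_mul_of_nonneg_left h2 (sub_nonneg.2 (hp i).2.le)
  simp only [Pi.pow_apply]
  linarith

/-- Under the perturbed Bernoulli product measures `ν_{N,φ}` (density `ρ + (a_N/N) φ(x/N)`
at site `x`), the random variables `(N/a_N²) log (dν_ρ/dν_{N,φ})` converge in probability
to `-(1/(2ρ(1-ρ))) ∫₀¹ φ(u)² du` in the moderate-deviation scaling `√N ≪ a_N ≪ N`. -/
theorem log_RN_derivative_convergence_in_probability
    (ρ : ℝ) (hρ : ρ ∈ Set.Ioo (0 : ℝ) 1)
    (φ : ℝ → ℝ) (hφ : ContinuousOn φ (Set.Icc (0 : ℝ) 1))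
    (a : ℕ → ℝ) (ha : ∀ N, 0 < a N)
    (hlim1 : Tendsto (fun N : ℕ => a N / N) atTop (nhds 0))
    (hlim2 : Tendsto (fun N : ℕ => (N : ℝ) / (a N) ^ 2) atTop (nhds 0))
    (P : ∀ N : ℕ, Measure (Fin N → Bool))
    (hP : ∀ᶠ N : ℕ in atTop,
      (∀ x : Fin N, ρ + (a N / N) * φ ((x : ℝ) / N) ∈ Set.Ioo (0 : ℝ) 1) ∧
      ∀ η₀ : Fin N → Bool, P N {η₀} =
        ∏ x : Fin N,
          if η₀ x then ENNReal.ofReal (ρ + (a N / N) * φ ((x : ℝ) / N))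
          else ENNReal.ofReal (1 - ρ - (a N / N) * φ ((x : ℝ) / N))) :
    ∀ δ : ℝ, 0 < δ →
      Tendsto (fun N : ℕ => P N {η : Fin N → Bool | δ ≤
          |((N : ℝ) / (a N) ^ 2) * Real.log (∏ x : Fin N,
              if η x then ρ / (ρ + (a N / N) * φ ((x : ℝ) / N))
              else (1 - ρ) / (1 - ρ - (a N / N) * φ ((x : ℝ) / N)))
            + (1 / (2 * ρ * (1 - ρ))) * ∫ u in (0 : ℝ)..1, (φ u) ^ 2|})
        atTop (nhds 0) := by
  intro δ hδ
  have hρ0 := hρ.1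
  have hρ1 := sub_pos.2 hρ.2
  obtain ⟨C, hC, r, hr, hlog⟩ := exists_abs_bernoulliLogRatio_le hρ
  obtain ⟨M', hM'⟩ := isCompact_Icc.exists_bound_of_continuousOn hφ
  obtain ⟨M, hM, hφM⟩ : ∃ M > 0, ∀ u ∈ Set.Icc (0 : ℝ) 1, |φ u| ≤ M :=
    ⟨max M' 1, by positivity, fun u hu => (hM' u hu).trans (le_max_left _ _)⟩
  have hφx : ∀ N : ℕ, ∀ x : Fin N, |φ ((x : ℝ) / N)| ≤ M := fun N x =>
    hφM _ ⟨by positivity, div_le_one_of_le₀ (by exact_mod_cast x.2.le) (by positivity)⟩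
  have hεx : ∀ N : ℕ, ∀ x : Fin N, |a N / N * φ ((x : ℝ) / N)| ≤ a N / N * M := fun N x => by
    have := (ha N).le
    rw [abs_mul, abs_of_nonneg (by positivity)]
    exact mul_le_mul_of_nonneg_left (hφx N x) (by positivity)
  have hsmall : ∀ᶠ N : ℕ in atTop, a N / N * M < r := by
    have h := hlim1.mul_const M
    rw [zero_mul] at h
    exact h.eventually_lt_const hr
  have hmean : Tendsto (fun N : ℕ => (N : ℝ) / a N ^ 2 *
      ∑ x : Fin N, bernoulliLogRatioMean ρ (a N / N * φ ((x : ℝ) / N))) atTop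
      (nhds (-(1 / (2 * ρ * (1 - ρ)) * ∫ u in (0 : ℝ)..1, φ u ^ 2))) := by
    have hR := ((hφ.pow 2).tendsto_riemannSum_integral.const_mul (1 / (2 * ρ * (1 - ρ)))).neg
    have hE := hlim1.const_mul (C * M ^ 3)
    rw [mul_zero] at hE
    simp only [Pi.pow_apply] at hR
    refine hR.congr_dist (squeeze_zero' (Eventually.of_forall fun _ => dist_nonneg) ?_ hE)
    filter_upwards [hsmall, eventually_gt_atTop 0] with N hN hN0
    have hN0' : (0 : ℝ) < N := by exact_mod_cast hN0
    have haN := ha N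
    have e : (N : ℝ) / a N ^ 2 *
          (∑ x : Fin N, bernoulliLogRatioMean ρ (a N / N * φ ((x : ℝ) / N))) -
          -(1 / (2 * ρ * (1 - ρ)) * ((∑ x : Fin N, φ ((x : ℝ) / N) ^ 2) / N)) =
        (N : ℝ) / a N ^ 2 * ∑ x : Fin N, (bernoulliLogRatioMean ρ (a N / N * φ ((x : ℝ) / N)) +
          (a N / N * φ ((x : ℝ) / N)) ^ 2 / (2 * ρ * (1 - ρ))) := by
      rw [Finset.sum_add_distrib, ← Finset.sum_div]
      simp only [mul_pow]
      rw [← Finset.mul_sum]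
      field_simp
      ring
    rw [dist_comm, Real.dist_eq, e, abs_mul, abs_of_pos (by positivity)]
    calc _ ≤ (N : ℝ) / a N ^ 2 * ∑ x : Fin N, C * (a N / N * M) ^ 3 := by
          refine mul_le_mul_of_nonneg_left ?_ (by positivity)
          refine (Finset.abs_sum_le_sum_abs _ _).trans (Finset.sum_le_sum fun x _ => ?_)
          refine (hlog _ ((hεx N x).trans hN.le)).2.trans ?_
          gcongr
          exact hεx N x
      _ = C * M ^ 3 * (a N / N) := by
          rw [Finset.sum_const, Finset.card_univ, Fintype.card_fin, nsmul_eq_mul]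
          field_simp
  have hclose := (tendsto_add_const_iff
    (1 / (2 * ρ * (1 - ρ)) * ∫ u in (0 : ℝ)..1, φ u ^ 2)).2 hmean
  rw [neg_add_cancel] at hclose
  have hbound : Tendsto (fun N : ℕ => ENNReal.ofReal (4 * C ^ 2 * M ^ 2 / δ ^ 2 *
      ((N : ℝ) / a N ^ 2))) atTop (nhds 0) := by
    have h := ENNReal.tendsto_ofReal (hlim2.const_mul (4 * C ^ 2 * M ^ 2 / δ ^ 2))
    rwa [mul_zero, ENNReal.ofReal_zero] at h
  refine tendsto_of_tendsto_of_tendsto_of_le_of_le' tendsto_const_nhds hbound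
    (Eventually.of_forall fun _ => zero_le) ?_
  have hclose' := hclose.abs
  rw [abs_zero] at hclose'
  filter_upwards [hsmall, eventually_gt_atTop 0, hP, hclose'.eventually_lt_const (half_pos hδ)]
    with N hN hN0 hPN hm
  obtain ⟨hp, hPη⟩ := hPN
  have hN0' : (0 : ℝ) < N := by exact_mod_cast hN0
  have haN := ha N
  have hb : 0 < (N : ℝ) / a N ^ 2 := by positivity
  have hcheb := measure_bernoulliProduct_le_abs_sum_sub (P N)
    (fun x : Fin N => ρ + a N / N * φ ((x : ℝ) / N)) hp
    (fun η => by simp only [hPη, sub_add_eq_sub_sub])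
    (fun x => bernoulliLogRatio ρ (a N / N * φ ((x : ℝ) / N)))
    (fun _ => C * (a N / N * M))
    (fun x b => ((hlog _ ((hεx N x).trans hN.le)).1 b).trans
      (mul_le_mul_of_nonneg_left (hεx N x) hC.le))
    (c := δ / 2 / ((N : ℝ) / a N ^ 2)) (by positivity)
  refine (measure_mono fun η hη => ?_).trans (hcheb.trans_eq (congrArg _ ?_))
  · simp only [Set.mem_ofPred_eq] at hη ⊢
    rw [Real.log_prod fun x _ => ?_] at hη
    · have habs : ∀ y : ℝ, (N : ℝ) / a N ^ 2 * |y| = |(N : ℝ) / a N ^ 2 * y| := fun y => by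
        rw [abs_mul, abs_of_pos hb]
      rw [div_le_iff₀' hb, habs, mul_sub]
      simp only [← sub_sub]
      change δ ≤ |(N : ℝ) / a N ^ 2 *
        ∑ x : Fin N, bernoulliLogRatio ρ (a N / N * φ ((x : ℝ) / N)) (η x) + _| at hη
      change δ / 2 ≤ |_ - (N : ℝ) / a N ^ 2 *
        ∑ x : Fin N, bernoulliLogRatioMean ρ (a N / N * φ ((x : ℝ) / N))|
      have h := abs_add_le ((N : ℝ) / a N ^ 2 *
        ∑ x : Fin N, bernoulliLogRatio ρ (a N / N * φ ((x : ℝ) / N)) (η x) -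
        (N : ℝ) / a N ^ 2 * ∑ x : Fin N, bernoulliLogRatioMean ρ (a N / N * φ ((x : ℝ) / N)))
        ((N : ℝ) / a N ^ 2 * ∑ x : Fin N, bernoulliLogRatioMean ρ (a N / N * φ ((x : ℝ) / N)) +
        1 / (2 * ρ * (1 - ρ)) * ∫ u in (0 : ℝ)..1, φ u ^ 2)
      rw [← add_assoc, sub_add_cancel] at h
      linarith
    · have h := hp x
      split_ifs
      · exact (div_pos hρ0 h.1).ne'
      · exact (div_pos hρ1 (by linarith [h.2])).ne'
  · rw [Finset.sum_const, Finset.card_univ, Fintype.card_fin, nsmul_eq_mul]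
    field_simp
    ring
end
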